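/- arXiv:2605.06725 — 2 statements merged into one kernel-verified Lean document; each statement's English description precedes it below -/
import Mathlib

section
/- Let G = (V,E) be a finite simple graph that is K_{r+1}-free (r ≥ 1), and let c : V → ℕ be arbitrary nonnegative integers assigned to the vertices. Then ∑_{uv∈E} c_u·c_v ≤ (1 - 1/r)·(∑_{v∈V} c_v)²/2, where the edge sum ranges over the unordered edges of G. -/
/-- The weighted form of Turán's theorem (Motzkin–Straus): on a vertex set containing no
`(r + 1)`-clique, the total weight of the ordered adjacent pairs is at most `1 - 1 / r` times the
square of the total weight. -/
theorem SimpleGraph.CliqueFreeOn.mul_sum_sum_adj_le {V : Type*} {G : SimpleGraph V}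
    [DecidableRel G.Adj] {x : V → ℝ} (hx : ∀ v, 0 ≤ x v) {r : ℕ} (hr : 1 ≤ r) :
    ∀ {s : Finset V}, G.CliqueFreeOn s (r + 1) →
      (r : ℝ) * ∑ u ∈ s, ∑ v ∈ s, (if G.Adj u v then x u * x v else 0)
        ≤ ((r : ℝ) - 1) * (∑ v ∈ s, x v) ^ 2 := by
  induction r, hr using Nat.le_induction with
  | base =>
    intro s hs
    rw [one_add_one_eq_two, SimpleGraph.cliqueFreeOn_two] at hs
    have h : ∑ u ∈ s, ∑ v ∈ s, (if G.Adj u v then x u * x v else 0) = 0 := by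
      refine Finset.sum_eq_zero fun u hu => Finset.sum_eq_zero fun v hv => if_neg fun huv => ?_
      exact hs hu hv huv.ne huv
    simp [h]
  | succ r hr ih =>
    intro s hs
    obtain rfl | hne := s.eq_empty_or_nonempty
    · simp
    let d : V → ℝ := fun u => ∑ v ∈ s, if G.Adj u v then x v else 0
    obtain ⟨a, ha, hmax⟩ := s.exists_max_image d hne
    let A := s.filter (G.Adj a)
    let B := s.filter (fun v => ¬ G.Adj a v)
    have hsplit (f : V → ℝ) : ∑ v ∈ s, f v = ∑ v ∈ A, f v + ∑ v ∈ B, f v :=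
      (Finset.sum_filter_add_sum_filter_not s (G.Adj a) f).symm
    have hA := ih (s := A) (by
      convert hs.of_succ _ (Finset.mem_coe.2 ha)
      ext v
      simp [A])
    have hda : d a = ∑ v ∈ A, x v := (Finset.sum_filter (G.Adj a) x).symm
    have hrow (u : V) :
        ∑ v ∈ s, (if G.Adj u v then x u * x v else 0) = x u * d u := by
      simp [d, Finset.mul_sum]
    have hB : ∑ u ∈ B, ∑ v ∈ s, (if G.Adj u v then x u * x v else 0)
        ≤ (∑ u ∈ B, x u) * d a := by
      rw [Finset.sum_mul]
      refine Finset.sum_le_sum fun u hu => ?_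
      rw [hrow]
      exact mul_le_mul_of_nonneg_left (hmax u (Finset.mem_filter.1 hu).1) (hx u)
    have hAB : ∑ u ∈ A, ∑ v ∈ B, (if G.Adj u v then x u * x v else 0)
        ≤ ∑ u ∈ B, ∑ v ∈ s, (if G.Adj u v then x u * x v else 0) := by
      rw [Finset.sum_comm]
      refine Finset.sum_le_sum fun u _ => ?_
      simp_rw [G.adj_comm _ u, mul_comm _ (x u)]
      refine Finset.sum_le_sum_of_subset_of_nonneg (Finset.filter_subset _ _) fun v _ _ => ?_
      split_ifs
      exacts [mul_nonneg (hx u) (hx v), le_rfl]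
    have hQ : ∑ u ∈ s, ∑ v ∈ s, (if G.Adj u v then x u * x v else 0)
        = ∑ u ∈ A, ∑ v ∈ A, (if G.Adj u v then x u * x v else 0)
          + ∑ u ∈ A, ∑ v ∈ B, (if G.Adj u v then x u * x v else 0)
          + ∑ u ∈ B, ∑ v ∈ s, (if G.Adj u v then x u * x v else 0) := by
      rw [hsplit, ← Finset.sum_add_distrib]
      simp_rw [hsplit]
    rw [hsplit x]
    rw [hda] at hB
    have hr0 : (1 : ℝ) ≤ r := by exact_mod_cast hr
    generalize ∑ u ∈ s, ∑ v ∈ s, (if G.Adj u v then x u * x v else 0) = Q at *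
    generalize ∑ u ∈ A, ∑ v ∈ A, (if G.Adj u v then x u * x v else 0) = QA at *
    generalize ∑ v ∈ A, x v = D at *
    generalize ∑ v ∈ B, x v = E at *
    have hle : Q ≤ QA + 2 * (E * D) := by linarith
    push_cast
    rw [add_sub_cancel_right]
    refine le_of_mul_le_mul_left ?_ (zero_lt_one.trans_le hr0)
    have h₁ := mul_le_mul_of_nonneg_left hle (by positivity : 0 ≤ (r : ℝ) * (r + 1))
    have h₂ := mul_le_mul_of_nonneg_left hA (by positivity : 0 ≤ (r : ℝ) + 1)
    linarith [sq_nonneg ((r : ℝ) * E - D)]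

/-- Summing a symmetric function over ordered adjacent pairs counts every edge twice. -/
theorem SimpleGraph.sum_sum_adj_eq_two_mul_sum_edgeFinset {V : Type*} [Fintype V]
    (G : SimpleGraph V) [DecidableRel G.Adj] [Fintype G.edgeSet] (f : Sym2 V → ℝ) :
    ∑ u, ∑ v, (if G.Adj u v then f s(u, v) else 0) = 2 * ∑ e ∈ G.edgeFinset, f e := by
  classical
  have hdart : ∑ p : V × V with G.Adj p.1 p.2, f s(p.1, p.2) = ∑ d : G.Dart, f d.edge := by
    refine Finset.sum_bij' (fun p hp => ⟨p, (Finset.mem_filter.1 hp).2⟩) (fun d _ => d.toProd)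
      ?_ ?_ ?_ ?_ ?_ <;> simp +contextual [SimpleGraph.Dart.edge, SimpleGraph.Dart.adj]
  rw [← Fintype.sum_prod_type' (f := fun u v => if G.Adj u v then f s(u, v) else 0),
    ← Finset.sum_filter, hdart,
    ← Finset.sum_fiberwise_of_maps_to (g := SimpleGraph.Dart.edge) (t := G.edgeFinset)
      (fun d _ => SimpleGraph.mem_edgeFinset.2 d.edge_mem), Finset.mul_sum]
  refine Finset.sum_congr rfl fun e he => ?_
  rw [Finset.sum_congr rfl fun d hd => congrArg f (Finset.mem_filter.1 hd).2, Finset.sum_const,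
    G.dart_edge_fiber_card e (SimpleGraph.mem_edgeFinset.1 he), nsmul_eq_mul, Nat.cast_ofNat]

/-- If `G` is a `K_{r+1}`-free finite simple graph (`r ≥ 1`) and `c` assigns a nonnegative
integer to each vertex, then `∑_{uv ∈ E(G)} c u * c v ≤ (1 - 1/r) * (∑ v, c v)^2 / 2`,
the edge sum ranging over the unordered edges of `G`. -/
theorem stmt_5 {V : Type*} [Fintype V] (G : SimpleGraph V) [DecidableRel G.Adj]
    (r : ℕ) (hr : 1 ≤ r) (hfree : G.CliqueFree (r + 1)) (c : V → ℕ) :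
    ∑ e ∈ G.edgeFinset, Sym2.lift ⟨fun u v => (c u : ℝ) * (c v : ℝ), fun _ _ => mul_comm _ _⟩ e
      ≤ (1 - 1 / (r : ℝ)) * (∑ v, (c v : ℝ)) ^ 2 / 2 := by
  have hr0 : (0 : ℝ) < r := by exact_mod_cast hr
  have hmain := (hfree.cliqueFreeOn (s := ((Finset.univ : Finset V) : Set V))).mul_sum_sum_adj_le
    (fun v => Nat.cast_nonneg (α := ℝ) (c v)) hr
  have htwo := G.sum_sum_adj_eq_two_mul_sum_edgeFinset
    (Sym2.lift ⟨fun u v => (c u : ℝ) * (c v : ℝ), fun _ _ => mul_comm _ _⟩)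
  simp only [Sym2.lift_mk] at htwo
  rw [htwo] at hmain
  rw [one_sub_div hr0.ne', div_mul_eq_mul_div, div_div, le_div_iff₀ (by positivity)]
  linarith
end

section
/- Let D = (V,A) be a finite oriented graph (A is an irreflexive, antisymmetric relation) and define the 3-graph E on V as all 3-element subsets {u,v,w} such that the subdigraph of D induced on {u,v,w} has at least 2 arcs and contains no vertex with two out-arcs inside {u,v,w}. Then for all nonnegative reals (x_v)_{v∈V} with ∑_{v∈V} x_v = 1, we have ∑_{{u,v,w}∈E} x_u·x_v·x_w + (1/2)·∑_{(u,v)∈A} x_u²·x_v ≤ 3/32. -/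
open scoped Classical

/-- The Fon-der-Flaass 3-graph of a digraph `A`: the edges are the 3-element sets `{u, v, w}`
such that the subdigraph induced on `{u, v, w}` has at least 2 arcs and contains no vertex with
two out-arcs inside `{u, v, w}`. -/
def fdfEdges {V : Type*} [DecidableEq V] (A : V → V → Prop) [DecidableRel A] :
    Set (Finset V) :=
  {t | ∃ u v w : V, u ≠ v ∧ u ≠ w ∧ v ≠ w ∧ t = {u, v, w} ∧
    2 ≤ ((if A u v then 1 else 0) + (if A v u then 1 else 0) + (if A u w then 1 else 0) +
          (if A w u then 1 else 0) + (if A v w then 1 else 0) + (if A w v then 1 else 0) : ℕ) ∧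
    ¬ ((A u v ∧ A u w) ∨ (A v u ∧ A v w) ∨ (A w u ∧ A w v))}

section Weighted

variable {V : Type*} [DecidableEq V]

/-- The total weight of the ordered edges inside `W`. -/
def edgeWeight (s : V → V → ℝ) (x : V → ℝ) (W : Finset V) : ℝ :=
  ∑ a ∈ W, ∑ b ∈ W, x a * x b * s a b

/-- The total weight of the ordered cherries inside `W`. -/
def cherryWeight (s : V → V → ℝ) (x : V → ℝ) (W : Finset V) : ℝ :=
  ∑ a ∈ W, ∑ b ∈ W, ∑ c ∈ W, x a * x b * x c * (s a b * s a c)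

/-- The total weight of the ordered triangles inside `W`. -/
def triangleWeight (s : V → V → ℝ) (x : V → ℝ) (W : Finset V) : ℝ :=
  ∑ a ∈ W, ∑ b ∈ W, ∑ c ∈ W, x a * x b * x c * (s a b * s a c * s b c)

/-- The weighted degree of `u` into `W`. -/
def degWeight (s : V → V → ℝ) (x : V → ℝ) (W : Finset V) (u : V) : ℝ :=
  ∑ w ∈ W, x w * s u w

/-- The weighted number of walks of length two in `W` that start at a neighbour of `u`. -/
def walkWeight (s : V → V → ℝ) (x : V → ℝ) (W : Finset V) (u : V) : ℝ :=
  ∑ a ∈ W, ∑ b ∈ W, x a * x b * (s u a * s a b)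

/-- The weighted number of ordered edges in the neighbourhood of `u` inside `W`. -/
def linkWeight (s : V → V → ℝ) (x : V → ℝ) (W : Finset V) (u : V) : ℝ :=
  ∑ a ∈ W, ∑ b ∈ W, x a * x b * (s u a * s u b * s a b)

/-- Three times the cherries minus twice the triangles counts the triples spanning at least two
edges; the last term penalizes the edge density. -/
noncomputable def graphPotential (s : V → V → ℝ) (x : V → ℝ) (W : Finset V) : ℝ :=
  3 * cherryWeight s x W - 2 * triangleWeight s x W - 3 / 4 * edgeWeight s x W ^ 2

variable {s : V → V → ℝ} {x : V → ℝ} {W : Finset V} {u v : V}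

lemma edgeWeight_insert (hsymm : ∀ a b, s a b = s b a) (hirr : ∀ a, s a a = 0) (hu : u ∉ W) :
    edgeWeight s x (insert u W) = edgeWeight s x W + 2 * x u * degWeight s x W u := by
  have h : ∑ a ∈ W, x a * x u * s a u = x u * ∑ w ∈ W, x w * s u w := by
    rw [Finset.mul_sum]
    exact Finset.sum_congr rfl fun a _ => by rw [hsymm a u]; ring
  have h' : ∑ a ∈ W, x u * x a * s u a = x u * ∑ w ∈ W, x w * s u w := by
    rw [Finset.mul_sum]
    exact Finset.sum_congr rfl fun a _ => by ring
  simp only [edgeWeight, degWeight, Finset.sum_insert hu, Finset.sum_add_distrib, h, h', hirr]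
  ring

lemma cherryWeight_insert (hsymm : ∀ a b, s a b = s b a) (hirr : ∀ a, s a a = 0)
    (hs : ∀ a b, s a b ^ 2 = s a b) (hu : u ∉ W) :
    cherryWeight s x (insert u W) = cherryWeight s x W + x u * degWeight s x W u ^ 2
      + 2 * x u * walkWeight s x W u + x u ^ 2 * degWeight s x W u := by
  have h1 : ∑ b ∈ W, ∑ c ∈ W, x u * x b * x c * (s u b * s u c)
      = x u * degWeight s x W u ^ 2 := by
    rw [degWeight, sq, Finset.sum_mul_sum, Finset.mul_sum]
    refine Finset.sum_congr rfl fun b _ => ?_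
    rw [Finset.mul_sum]
    exact Finset.sum_congr rfl fun c _ => by ring
  have h2 : ∑ a ∈ W, ∑ c ∈ W, x a * x u * x c * (s a u * s a c) = x u * walkWeight s x W u := by
    rw [walkWeight, Finset.mul_sum]
    refine Finset.sum_congr rfl fun b _ => ?_
    rw [Finset.mul_sum]
    exact Finset.sum_congr rfl fun c _ => by rw [hsymm b u]; ring
  have h3 : ∑ a ∈ W, ∑ b ∈ W, x a * x b * x u * (s a b * s a u) = x u * walkWeight s x W u := by
    rw [walkWeight, Finset.mul_sum]
    refine Finset.sum_congr rfl fun b _ => ?_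
    rw [Finset.mul_sum]
    exact Finset.sum_congr rfl fun c _ => by rw [hsymm b u]; ring
  have h4 : ∑ a ∈ W, x a * x u * x u * (s a u * s a u) = x u ^ 2 * degWeight s x W u := by
    rw [degWeight, Finset.mul_sum]
    refine Finset.sum_congr rfl fun a _ => ?_
    rw [hsymm a u, ← sq (s u a), hs]; ring
  simp only [cherryWeight, Finset.sum_insert hu, Finset.sum_add_distrib, h1, h2, h3, h4, hirr,
    zero_mul, mul_zero, Finset.sum_const_zero]
  ring

lemma triangleWeight_insert (hsymm : ∀ a b, s a b = s b a) (hirr : ∀ a, s a a = 0) (hu : u ∉ W) :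
    triangleWeight s x (insert u W) = triangleWeight s x W + 3 * x u * linkWeight s x W u := by
  have h1 : ∑ b ∈ W, ∑ c ∈ W, x u * x b * x c * (s u b * s u c * s b c)
      = x u * linkWeight s x W u := by
    rw [linkWeight, Finset.mul_sum]
    refine Finset.sum_congr rfl fun b _ => ?_
    rw [Finset.mul_sum]
    exact Finset.sum_congr rfl fun c _ => by ring
  have h2 : ∑ a ∈ W, ∑ c ∈ W, x a * x u * x c * (s a u * s a c * s u c)
      = x u * linkWeight s x W u := by
    rw [linkWeight, Finset.mul_sum]
    refine Finset.sum_congr rfl fun b _ => ?_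
    rw [Finset.mul_sum]
    exact Finset.sum_congr rfl fun c _ => by rw [hsymm b u]; ring
  have h3 : ∑ a ∈ W, ∑ b ∈ W, x a * x b * x u * (s a b * s a u * s b u)
      = x u * linkWeight s x W u := by
    rw [linkWeight, Finset.mul_sum]
    refine Finset.sum_congr rfl fun b _ => ?_
    rw [Finset.mul_sum]
    exact Finset.sum_congr rfl fun c _ => by rw [hsymm b u, hsymm c u]; ring
  simp only [triangleWeight, Finset.sum_insert hu, Finset.sum_add_distrib, h1, h2, h3, hirr,
    zero_mul, mul_zero, Finset.sum_const_zero]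
  ring

lemma degWeight_insert (hv : v ∉ W) (huv : s u v = 0) :
    degWeight s x (insert v W) u = degWeight s x W u := by
  simp [degWeight, Finset.sum_insert hv, huv]

lemma walkWeight_insert (hsymm : ∀ a b, s a b = s b a) (hv : v ∉ W) (huv : s u v = 0) :
    walkWeight s x (insert v W) u
      = walkWeight s x W u + x v * ∑ w ∈ W, x w * (s u w * s v w) := by
  have h : ∑ a ∈ W, x a * x v * (s u a * s a v) = x v * ∑ w ∈ W, x w * (s u w * s v w) := by
    rw [Finset.mul_sum]
    exact Finset.sum_congr rfl fun a _ => by rw [hsymm a v]; ring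
  simp only [walkWeight, Finset.sum_insert hv, Finset.sum_add_distrib, h, huv, zero_mul, mul_zero,
    Finset.sum_const_zero]
  ring

lemma linkWeight_insert (hv : v ∉ W) (huv : s u v = 0) :
    linkWeight s x (insert v W) u = linkWeight s x W u := by
  simp [linkWeight, Finset.sum_insert hv, huv]

/-- The potential of `insert u W` when the weight of `u` is reset to `r`. -/
lemma graphPotential_insert_update (hsymm : ∀ a b, s a b = s b a) (hirr : ∀ a, s a a = 0)
    (hs : ∀ a b, s a b ^ 2 = s a b) (hu : u ∉ W) (r : ℝ) :
    graphPotential s (Function.update x u r) (insert u W)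
      = 3 * (cherryWeight s x W + r * degWeight s x W u ^ 2 + 2 * r * walkWeight s x W u
          + r ^ 2 * degWeight s x W u)
        - 2 * (triangleWeight s x W + 3 * r * linkWeight s x W u)
        - 3 / 4 * (edgeWeight s x W + 2 * r * degWeight s x W u) ^ 2 := by
  have hx : ∀ a ∈ W, Function.update x u r a = x a := fun a ha =>
    Function.update_of_ne (ne_of_mem_of_not_mem ha hu) _ _
  have e1 : edgeWeight s (Function.update x u r) W = edgeWeight s x W :=
    Finset.sum_congr rfl fun a ha => Finset.sum_congr rfl fun b hb => by rw [hx a ha, hx b hb]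
  have e2 : cherryWeight s (Function.update x u r) W = cherryWeight s x W :=
    Finset.sum_congr rfl fun a ha => Finset.sum_congr rfl fun b hb =>
      Finset.sum_congr rfl fun c hc => by rw [hx a ha, hx b hb, hx c hc]
  have e3 : triangleWeight s (Function.update x u r) W = triangleWeight s x W :=
    Finset.sum_congr rfl fun a ha => Finset.sum_congr rfl fun b hb =>
      Finset.sum_congr rfl fun c hc => by rw [hx a ha, hx b hb, hx c hc]
  have e4 : degWeight s (Function.update x u r) W u = degWeight s x W u :=
    Finset.sum_congr rfl fun a ha => by rw [hx a ha]
  have e5 : walkWeight s (Function.update x u r) W u = walkWeight s x W u :=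
    Finset.sum_congr rfl fun a ha => Finset.sum_congr rfl fun b hb => by rw [hx a ha, hx b hb]
  have e6 : linkWeight s (Function.update x u r) W u = linkWeight s x W u :=
    Finset.sum_congr rfl fun a ha => Finset.sum_congr rfl fun b hb => by rw [hx a ha, hx b hb]
  rw [graphPotential, cherryWeight_insert hsymm hirr hs hu, triangleWeight_insert hsymm hirr hu,
    edgeWeight_insert hsymm hirr hu, e1, e2, e3, e4, e5, e6, Function.update_self]

/-- Two non-adjacent vertices can be merged, in one of the two directions, without decreasing
the potential. -/
lemma add_mul_graphPotential_le (hsymm : ∀ a b, s a b = s b a) (hirr : ∀ a, s a a = 0)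
    (h01 : ∀ a b, s a b = 0 ∨ s a b = 1) (hu : u ∉ W) (hv : v ∉ W) (hne : u ≠ v)
    (huv : s u v = 0) (hx : ∀ w, 0 ≤ x w) (hW : ∑ w ∈ W, x w ≤ 1) :
    (x u + x v) * graphPotential s x (insert u (insert v W))
      ≤ x u * graphPotential s (Function.update x u (x u + x v)) (insert u W)
        + x v * graphPotential s (Function.update x v (x u + x v)) (insert v W) := by
  have hs : ∀ a b, s a b ^ 2 = s a b := fun a b => by rcases h01 a b with h | h <;> simp [h]
  have hu' : u ∉ insert v W := by simp [hne, hu]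
  rw [graphPotential_insert_update hsymm hirr hs hu, graphPotential_insert_update hsymm hirr hs hv,
    graphPotential, cherryWeight_insert hsymm hirr hs hu', cherryWeight_insert hsymm hirr hs hv,
    triangleWeight_insert hsymm hirr hu', triangleWeight_insert hsymm hirr hv,
    edgeWeight_insert hsymm hirr hu', edgeWeight_insert hsymm hirr hv,
    degWeight_insert hv huv, walkWeight_insert hsymm hv huv, linkWeight_insert hv huv]
  have hcu : ∑ w ∈ W, x w * (s u w * s v w) ≤ degWeight s x W u :=
    Finset.sum_le_sum fun w _ => mul_le_mul_of_nonneg_left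
      (by rcases h01 u w with h | h <;> rcases h01 v w with h' | h' <;> simp [h, h']) (hx w)
  have hcv : ∑ w ∈ W, x w * (s u w * s v w) ≤ degWeight s x W v :=
    Finset.sum_le_sum fun w _ => mul_le_mul_of_nonneg_left
      (by rcases h01 u w with h | h <;> rcases h01 v w with h' | h' <;> simp [h, h']) (hx w)
  have hdeg0 : ∀ z, 0 ≤ degWeight s x W z := fun z =>
    Finset.sum_nonneg fun w _ => mul_nonneg (hx w) (by rcases h01 z w with h | h <;> simp [h])
  have hdeg1 : ∀ z, degWeight s x W z ≤ 1 := fun z => le_trans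
    (Finset.sum_le_sum fun w _ => mul_le_of_le_one_right (hx w)
      (by rcases h01 z w with h | h <;> simp [h])) hW
  have hu0 := hdeg0 u
  have hv0 := hdeg0 v
  have hu1 := hdeg1 u
  have hv1 := hdeg1 v
  generalize degWeight s x W u = du at *
  generalize degWeight s x W v = dv at *
  generalize ∑ w ∈ W, x w * (s u w * s v w) = c at *
  have key : (du - dv) ^ 2 ≤ du + dv - 2 * c := by
    rcases le_total du dv with h | h <;> nlinarith
  have := mul_nonneg (mul_nonneg (mul_nonneg (hx u) (hx v)) (add_nonneg (hx u) (hx v)))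
    (sub_nonneg.2 key)
  linarith

lemma graphPotential_clique (hirr : ∀ a, s a a = 0)
    (hW : ∀ a ∈ W, ∀ b ∈ W, a ≠ b → s a b = 1) (hsum : ∑ w ∈ W, x w = 1) :
    graphPotential s x W
      = 1 - ∑ w ∈ W, x w ^ 3 - 3 / 4 * (1 - ∑ w ∈ W, x w ^ 2) ^ 2 := by
  have hdel : ∀ a ∈ W, ∀ g : V → ℝ, ∑ b ∈ W, g b * s a b = ∑ b ∈ W, g b - g a := by
    intro a ha g
    rw [← Finset.add_sum_erase W _ ha, ← Finset.add_sum_erase W g ha, hirr,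
      Finset.sum_congr rfl fun b hb => by
        rw [hW a ha b (Finset.mem_of_mem_erase hb) (Finset.ne_of_mem_erase hb).symm, mul_one]]
    ring
  have he : edgeWeight s x W = 1 - ∑ w ∈ W, x w ^ 2 := by
    rw [edgeWeight, Finset.sum_congr rfl fun a ha => hdel a ha fun b => x a * x b]
    simp only [← Finset.mul_sum, hsum, Finset.sum_sub_distrib, mul_one, sq]
  have hc : cherryWeight s x W = 1 - 2 * ∑ w ∈ W, x w ^ 2 + ∑ w ∈ W, x w ^ 3 := by
    have : ∀ a ∈ W, ∑ b ∈ W, ∑ c ∈ W, x a * x b * x c * (s a b * s a c)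
        = x a - 2 * x a ^ 2 + x a ^ 3 := by
      intro a ha
      have : ∀ b ∈ W, ∑ c ∈ W, x a * x b * x c * (s a b * s a c)
          = x a * (1 - x a) * x b * s a b := by
        intro b _
        rw [Finset.sum_congr rfl fun c _ =>
          show _ = (x a * x b * s a b * x c) * s a c by ring,
          hdel a ha fun c => x a * x b * s a b * x c, ← Finset.mul_sum, hsum]
        ring
      rw [Finset.sum_congr rfl this, hdel a ha fun b => x a * (1 - x a) * x b,
        ← Finset.mul_sum, hsum]
      ring
    rw [cherryWeight, Finset.sum_congr rfl this, Finset.sum_add_distrib, Finset.sum_sub_distrib,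
      ← Finset.mul_sum, hsum]
  have ht : triangleWeight s x W = 1 - 3 * ∑ w ∈ W, x w ^ 2 + 2 * ∑ w ∈ W, x w ^ 3 := by
    have : ∀ a ∈ W, ∑ b ∈ W, ∑ c ∈ W, x a * x b * x c * (s a b * s a c * s b c)
        = x a - 2 * x a ^ 2 + 2 * x a ^ 3 - (∑ w ∈ W, x w ^ 2) * x a := by
      intro a ha
      have : ∀ b ∈ W, ∑ c ∈ W, x a * x b * x c * (s a b * s a c * s b c)
          = (x a * (1 - x a) * x b - x a * x b ^ 2) * s a b := by
        intro b hb
        rw [Finset.sum_congr rfl fun c _ =>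
          show _ = (x a * x b * s a b * x c * s a c) * s b c by ring,
          hdel b hb fun c => x a * x b * s a b * x c * s a c,
          hdel a ha fun c => x a * x b * s a b * x c, ← Finset.mul_sum, hsum]
        by_cases hab : a = b
        · subst hab
          rw [hirr]; ring
        · rw [hW a ha b hb hab]; ring
      rw [Finset.sum_congr rfl this, hdel a ha fun b => x a * (1 - x a) * x b - x a * x b ^ 2,
        Finset.sum_sub_distrib, ← Finset.mul_sum, ← Finset.mul_sum, hsum]
      ring
    rw [triangleWeight, Finset.sum_congr rfl this, Finset.sum_sub_distrib, Finset.sum_add_distrib,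
      Finset.sum_sub_distrib, ← Finset.mul_sum, ← Finset.mul_sum, ← Finset.mul_sum, hsum]
    ring
  rw [graphPotential, he, hc, ht]
  ring

lemma cube_sum_three_bound {a b c : ℝ} (h : a + b + c = 1) :
    7 / 16 ≤ a ^ 3 + b ^ 3 + c ^ 3 + 3 / 4 * (1 - (a ^ 2 + b ^ 2 + c ^ 2)) ^ 2 := by
  obtain rfl : c = 1 - a - b := by linarith
  set c := 1 - a - b
  nlinarith [sq_nonneg ((a - b) * (a + b - c)), sq_nonneg ((b - c) * (b + c - a)),
    sq_nonneg ((a - c) * (a + c - b)), sq_nonneg (a * b + a * c + b * c - 1 / 4)]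

lemma sum_insert_update_pow {M : ℕ} (hu : u ∉ W) (r : ℝ) :
    ∑ w ∈ insert u W, Function.update x u r w ^ M = r ^ M + ∑ w ∈ W, x w ^ M := by
  rw [Finset.sum_insert hu, Function.update_self]
  congr 1
  exact Finset.sum_congr rfl fun a ha => by
    rw [Function.update_of_ne (ne_of_mem_of_not_mem ha hu)]

lemma exists_pair_add_le_half (hx : ∀ w, 0 ≤ x w) (hsum : ∑ w ∈ W, x w = 1) (hW : 4 ≤ W.card) :
    ∃ u ∈ W, ∃ v ∈ W, u ≠ v ∧ x u + x v ≤ 1 / 2 := by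
  obtain ⟨T, hT, hcard⟩ := Finset.exists_subset_card_eq hW
  obtain ⟨a, b, c, d, hab, hac, had, hbc, hbd, hcd, rfl⟩ := Finset.card_eq_four.1 hcard
  have hle := Finset.sum_le_sum_of_subset_of_nonneg hT fun w _ _ => hx w
  rw [Finset.sum_insert (by simp [hab, hac, had]), Finset.sum_insert (by simp [hbc, hbd]),
    Finset.sum_pair hcd, hsum] at hle
  rcases le_total (x a + x b) (1 / 2) with h | h
  · exact ⟨a, hT (by simp), b, hT (by simp), hab, h⟩
  · exact ⟨c, hT (by simp), d, hT (by simp), hcd, by linarith⟩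

lemma cube_sum_bound (n : ℕ) : ∀ (W : Finset V) (x : V → ℝ), W.card = n → (∀ w, 0 ≤ x w) →
    ∑ w ∈ W, x w = 1 → 7 / 16 ≤ ∑ w ∈ W, x w ^ 3 + 3 / 4 * (1 - ∑ w ∈ W, x w ^ 2) ^ 2 := by
  induction n with
  | zero =>
    intro W x hW _ hsum
    simp [Finset.card_eq_zero.1 hW] at hsum
  | succ n ih =>
    intro W x hW hx hsum
    rcases le_or_gt 4 W.card with h4 | h4
    · obtain ⟨u, huW, v, hvW, hne, hle⟩ := exists_pair_add_le_half hx hsum h4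
      obtain ⟨R, hu, hv, rfl⟩ : ∃ R : Finset V, u ∉ R ∧ v ∉ R ∧ W = insert u (insert v R) :=
        ⟨(W.erase u).erase v, by simp, by simp, by
          rw [Finset.insert_erase (Finset.mem_erase.2 ⟨hne.symm, hvW⟩), Finset.insert_erase huW]⟩
      have hu' : u ∉ insert v R := by simp [hne, hu]
      rw [Finset.card_insert_of_notMem hu', Finset.card_insert_of_notMem hv] at hW
      have h1 := sum_insert_update_pow (x := x) (M := 1) hu (x u + x v)
      have h2 := sum_insert_update_pow (x := x) (M := 2) hu (x u + x v)
      have h3 := sum_insert_update_pow (x := x) (M := 3) hu (x u + x v)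
      rw [Finset.sum_insert hu', Finset.sum_insert hv] at hsum
      simp only [pow_one] at h1
      have key := ih (insert u R) (Function.update x u (x u + x v))
        (by rw [Finset.card_insert_of_notMem hu]; omega)
        (fun w => by
          by_cases h : w = u
          · subst h; simpa using add_nonneg (hx w) (hx v)
          · simpa [h] using hx w)
        (by rw [h1]; linarith)
      rw [h2, h3] at key
      rw [Finset.sum_insert hu', Finset.sum_insert hv, Finset.sum_insert hu',
        Finset.sum_insert hv]
      have hu0 := hx u
      have hv0 := hx v
      have hS : ∑ w ∈ R, x w ^ 2 ≤ (∑ w ∈ R, x w) ^ 2 :=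
        Finset.sum_sq_le_sq_sum_of_nonneg fun w _ => hx w
      rw [show ∑ w ∈ R, x w = 1 - x u - x v by linarith] at hS
      generalize ∑ w ∈ R, x w ^ 2 = S2 at *
      generalize ∑ w ∈ R, x w ^ 3 = S3 at *
      have hP := mul_nonneg hu0 hv0
      have hd : x u + x v + x u * x v ≤ 1 - (x u ^ 2 + (x v ^ 2 + S2)) := by
        nlinarith [mul_nonneg (add_nonneg hu0 hv0) (sub_nonneg.2 hle)]
      nlinarith [mul_nonneg hP (sub_nonneg.2 hd)]
    · have : W.card = 1 ∨ W.card = 2 ∨ W.card = 3 := by omega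
      rcases this with h | h | h
      · obtain ⟨a, rfl⟩ := Finset.card_eq_one.1 h
        simp only [Finset.sum_singleton] at hsum ⊢
        rw [hsum]; norm_num
      · obtain ⟨a, b, hab, rfl⟩ := Finset.card_eq_two.1 h
        rw [Finset.sum_pair hab] at hsum ⊢
        rw [Finset.sum_pair hab]
        simpa using cube_sum_three_bound (a := x a) (b := x b) (c := 0) (by linarith)
      · obtain ⟨a, b, c, hab, hac, hbc, rfl⟩ := Finset.card_eq_three.1 h
        have ha : a ∉ ({b, c} : Finset V) := by simp [hab, hac]
        simp only [Finset.sum_insert ha, Finset.sum_pair hbc] at hsum ⊢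
        have := cube_sum_three_bound (a := x a) (b := x b) (c := x c) (by linarith)
        simpa only [add_assoc] using this

lemma graphPotential_le (hsymm : ∀ a b, s a b = s b a) (hirr : ∀ a, s a a = 0)
    (h01 : ∀ a b, s a b = 0 ∨ s a b = 1) (n : ℕ) :
    ∀ (W : Finset V) (x : V → ℝ), W.card = n → (∀ w, 0 ≤ x w) → ∑ w ∈ W, x w = 1 →
      graphPotential s x W ≤ 9 / 16 := by
  induction n with
  | zero =>
    intro W x hW _ hsum
    simp [Finset.card_eq_zero.1 hW] at hsum
  | succ n ih =>
    intro W x hW hx hsum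
    by_cases hcl : ∀ a ∈ W, ∀ b ∈ W, a ≠ b → s a b = 1
    · rw [graphPotential_clique hirr hcl hsum]
      linarith [cube_sum_bound _ W x rfl hx hsum]
    · push Not at hcl
      obtain ⟨u, huW, v, hvW, hne, huv⟩ := hcl
      replace huv : s u v = 0 := (h01 u v).resolve_right huv
      obtain ⟨R, hu, hv, rfl⟩ : ∃ R : Finset V, u ∉ R ∧ v ∉ R ∧ W = insert u (insert v R) :=
        ⟨(W.erase u).erase v, by simp, by simp, by
          rw [Finset.insert_erase (Finset.mem_erase.2 ⟨hne.symm, hvW⟩), Finset.insert_erase huW]⟩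
      have hu' : u ∉ insert v R := by simp [hne, hu]
      rw [Finset.card_insert_of_notMem hu', Finset.card_insert_of_notMem hv] at hW
      rw [Finset.sum_insert hu', Finset.sum_insert hv] at hsum
      have merged : ∀ z, z ∉ R →
          graphPotential s (Function.update x z (x u + x v)) (insert z R) ≤ 9 / 16 := by
        intro z hz
        have h1 := sum_insert_update_pow (x := x) (M := 1) hz (x u + x v)
        simp only [pow_one] at h1
        refine ih _ _ (by rw [Finset.card_insert_of_notMem hz]; omega) (fun w => ?_)
          (by rw [h1]; linarith)
        by_cases h : w = z
        · subst h; simpa using add_nonneg (hx u) (hx v)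
        · simpa [h] using hx w
      have hkey := add_mul_graphPotential_le hsymm hirr h01 hu hv hne huv hx
        (by linarith [hx u, hx v])
      have hmu := mul_le_mul_of_nonneg_left (merged u hu) (hx u)
      have hmv := mul_le_mul_of_nonneg_left (merged v hv) (hx v)
      rcases (add_nonneg (hx u) (hx v)).eq_or_lt with h0 | hpos
      · have hxu : x u = 0 := by linarith [hx u, hx v]
        have hxv : x v = 0 := by linarith [hx u, hx v]
        have hs : ∀ a b, s a b ^ 2 = s a b := fun a b => by
          rcases h01 a b with h | h <;> simp [h]
        have hm := merged v hv
        rw [← h0, ← hxv, Function.update_eq_self] at hm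
        rw [graphPotential] at hm ⊢
        rw [cherryWeight_insert hsymm hirr hs hu', triangleWeight_insert hsymm hirr hu',
          edgeWeight_insert hsymm hirr hu', hxu]
        simpa using hm
      · refine le_of_mul_le_mul_left ?_ hpos
        linarith

end Weighted

section Oriented

variable {V : Type*}

/-- The ordered triples of distinct vertices that span an edge of the Fon-der-Flaass 3-graph. -/
def IsFdfTriple (A : V → V → Prop) [DecidableRel A] (u v w : V) : Prop :=
  u ≠ v ∧ u ≠ w ∧ v ≠ w ∧
    2 ≤ ((if A u v then 1 else 0) + (if A v u then 1 else 0) + (if A u w then 1 else 0) +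
          (if A w u then 1 else 0) + (if A v w then 1 else 0) + (if A w v then 1 else 0) : ℕ) ∧
    ¬ ((A u v ∧ A u w) ∨ (A v u ∧ A v w) ∨ (A w u ∧ A w v))

variable {A : V → V → Prop} [DecidableRel A] {u v w : V}

lemma IsFdfTriple.swap_left (h : IsFdfTriple A u v w) : IsFdfTriple A v u w := by
  obtain ⟨h1, h2, h3, h4, h5⟩ := h
  exact ⟨h1.symm, h3, h2, by omega, by tauto⟩

lemma IsFdfTriple.swap_right (h : IsFdfTriple A u v w) : IsFdfTriple A u w v := by
  obtain ⟨h1, h2, h3, h4, h5⟩ := h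
  exact ⟨h2, h1, h3.symm, by omega, by tauto⟩

lemma six_mul_sum_fdfEdges_le [Fintype V] [DecidableEq V] {x : V → ℝ} (hx : ∀ v, 0 ≤ x v) :
    6 * ∑ t ∈ Finset.univ.filter (fun t : Finset V => t ∈ fdfEdges A), ∏ v ∈ t, x v
      ≤ ∑ u, ∑ v, ∑ w, if IsFdfTriple A u v w then x u * x v * x w else 0 := by
  have hrhs : (∑ u, ∑ v, ∑ w, if IsFdfTriple A u v w then x u * x v * x w else 0)
      = ∑ p ∈ Finset.univ.filter (fun p : V × V × V => IsFdfTriple A p.1 p.2.1 p.2.2),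
          x p.1 * x p.2.1 * x p.2.2 := by
    simp only [Finset.sum_filter, Fintype.sum_prod_type]
  rw [hrhs, ← Finset.sum_fiberwise_of_maps_to
    (t := Finset.univ.filter (fun t : Finset V => t ∈ fdfEdges A))
    (g := fun p : V × V × V => ({p.1, p.2.1, p.2.2} : Finset V)), Finset.mul_sum]
  · refine Finset.sum_le_sum fun t ht => ?_
    obtain ⟨u, v, w, huv, huw, hvw, rfl, h4, h5⟩ := (Finset.mem_filter.1 ht).2
    have h : IsFdfTriple A u v w := ⟨huv, huw, hvw, h4, h5⟩
    have hsub : ({(u, v, w), (u, w, v), (v, u, w), (v, w, u), (w, u, v), (w, v, u)} :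
        Finset (V × V × V)) ⊆ (Finset.univ.filter
          (fun p : V × V × V => IsFdfTriple A p.1 p.2.1 p.2.2)).filter
          (fun p => ({p.1, p.2.1, p.2.2} : Finset V) = {u, v, w}) := by
      intro p hp
      simp only [Finset.mem_insert, Finset.mem_singleton] at hp
      simp only [Finset.mem_filter, Finset.mem_univ, true_and]
      rcases hp with rfl | rfl | rfl | rfl | rfl | rfl
      · exact ⟨h, rfl⟩
      · exact ⟨h.swap_right, by ext; simp; tauto⟩
      · exact ⟨h.swap_left, by ext; simp; tauto⟩
      · exact ⟨h.swap_left.swap_right, by ext; simp; tauto⟩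
      · exact ⟨h.swap_right.swap_left, by ext; simp; tauto⟩
      · exact ⟨h.swap_right.swap_left.swap_right, by ext; simp; tauto⟩
    refine le_trans (le_of_eq ?_) (Finset.sum_le_sum_of_subset_of_nonneg hsub fun p _ _ =>
      mul_nonneg (mul_nonneg (hx _) (hx _)) (hx _))
    rw [Finset.prod_insert (by simp [huv, huw]), Finset.prod_pair hvw,
      Finset.sum_insert (by simp [huv, huw, hvw, hvw.symm, huv.symm, huw.symm]),
      Finset.sum_insert (by simp [huv, huw, hvw, hvw.symm, huv.symm, huw.symm]),
      Finset.sum_insert (by simp [huv, huw, hvw, hvw.symm, huw.symm]),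
      Finset.sum_insert (by simp [huv, hvw, hvw.symm, huw.symm]),
      Finset.sum_insert (by simp [huv, huv.symm]),
      Finset.sum_singleton]
    ring
  · intro p hp
    obtain ⟨h1, h2, h3, h4, h5⟩ := (Finset.mem_filter.1 hp).2
    exact Finset.mem_filter.2 ⟨Finset.mem_univ _, _, _, _, h1, h2, h3, rfl, h4, h5⟩

/-- The real-valued indicator of the arcs of `A`. -/
noncomputable def arcInd (A : V → V → Prop) [DecidableRel A] (u v : V) : ℝ := if A u v then 1 else 0

lemma fdfTriple_indicator_le [DecidableEq V] (hirr : ∀ v, ¬ A v v) (hanti : ∀ u v, A u v → ¬ A v u) (u v w : V) :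
    (if IsFdfTriple A u v w then (1 : ℝ) else 0) + (if u = v then arcInd A u w else 0)
        + (if u = w then arcInd A u v else 0) + (if v = w then arcInd A v u else 0)
      ≤ ((arcInd A u v + arcInd A v u) * (arcInd A u w + arcInd A w u)
          + (arcInd A v u + arcInd A u v) * (arcInd A v w + arcInd A w v)
          + (arcInd A w u + arcInd A u w) * (arcInd A w v + arcInd A v w))
        - 2 * ((arcInd A u v + arcInd A v u) * (arcInd A u w + arcInd A w u)
          * (arcInd A v w + arcInd A w v))
        - (arcInd A u v * arcInd A u w + arcInd A v u * arcInd A v w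
          + arcInd A w u * arcInd A w v) := by
  by_cases huv : u = v
  · subst huv
    have hf : ¬ IsFdfTriple A u u w := fun h => h.1 rfl
    have h1 := hirr u
    by_cases huw : u = w
    · subst huw
      simp [arcInd, hf, h1]
    · have h2 := hanti u w
      by_cases a : A u w <;> by_cases b : A w u <;> simp_all [arcInd]
  by_cases huw : u = w
  · subst huw
    have hf : ¬ IsFdfTriple A u v u := fun h => h.2.1 rfl
    have h1 := hirr u
    have h2 := hanti u v
    by_cases a : A u v <;> by_cases b : A v u <;> simp_all [arcInd, Ne.symm huv]
  by_cases hvw : v = w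
  · subst hvw
    have hf : ¬ IsFdfTriple A u v v := fun h => h.2.2.1 rfl
    have h1 := hirr v
    have h2 := hanti u v
    by_cases a : A u v <;> by_cases b : A v u <;> simp_all [arcInd]
  have h1 := hanti u v
  have h2 := hanti u w
  have h3 := hanti v w
  simp only [huv, huw, hvw, if_false, add_zero]
  by_cases a : A u v <;> by_cases b : A v u <;> by_cases c : A u w <;> by_cases d : A w u <;>
    by_cases e : A v w <;> by_cases f : A w v <;>
    simp_all [arcInd, IsFdfTriple] <;> norm_num

end Oriented

/-- For any oriented graph `A` on a finite vertex set `V`, its Fon-der-Flaass 3-graph `E`, and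
nonnegative vertex weights `x` summing to `1`, we have
`∑_{{u,v,w} ∈ E} x u * x v * x w + (1/2) * ∑_{(u,v) : A u v} (x u)^2 * x v ≤ 3/32`. -/
theorem stmt_11 {V : Type*} [Fintype V] [DecidableEq V] (A : V → V → Prop) [DecidableRel A]
    (hirr : ∀ v, ¬ A v v) (hanti : ∀ u v, A u v → ¬ A v u)
    (x : V → ℝ) (hx : ∀ v, 0 ≤ x v) (hsum : ∑ v, x v = 1) :
    ∑ t ∈ Finset.univ.filter (fun t : Finset V => t ∈ fdfEdges A), ∏ v ∈ t, x v
      + (1 / 2) * ∑ p ∈ Finset.univ.filter (fun p : V × V => A p.1 p.2), x p.1 ^ 2 * x p.2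
      ≤ 3 / 32 := by
  have hE := six_mul_sum_fdfEdges_le (A := A) hx
  set a := arcInd A with ha
  set s : V → V → ℝ := fun u v => a u v + a v u with hs
  set q : V → ℝ := fun u => ∑ v, x v * a u v with hq
  have hB : ∑ p ∈ Finset.univ.filter (fun p : V × V => A p.1 p.2), x p.1 ^ 2 * x p.2
      = ∑ u, ∑ v, x u ^ 2 * x v * a u v := by
    simp [Finset.sum_filter, Fintype.sum_prod_type, ha, arcInd]
  set B := ∑ u, ∑ v, x u ^ 2 * x v * a u v
  have hpot : graphPotential s x Finset.univ ≤ 9 / 16 := by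
    refine graphPotential_le (fun u v => add_comm _ _) (fun u => ?_) (fun u v => ?_) _ _ _ rfl hx
      hsum
    · simp [ha, arcInd, hirr u]
    · have := hanti u v
      by_cases h : A u v <;> by_cases h' : A v u <;> simp_all [arcInd]
  have hedge : edgeWeight s x Finset.univ = 2 * ∑ u, x u * q u := by
    have h1 : ∑ u, ∑ v, x u * x v * a u v = ∑ u, x u * q u := by
      simp only [hq, Finset.mul_sum, mul_assoc]
    have h2 : ∑ u, ∑ v, x u * x v * a v u = ∑ u, x u * q u := by
      rw [← h1, Finset.sum_comm]
      exact Finset.sum_congr rfl fun u _ => Finset.sum_congr rfl fun v _ => by ring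
    simp only [edgeWeight, hs, mul_add, Finset.sum_add_distrib, h1, h2]
    ring
  have hjensen : (∑ u, x u * q u) ^ 2 ≤ ∑ u, x u * q u ^ 2 := by
    have := Finset.sum_nonneg fun u (_ : u ∈ Finset.univ) =>
      mul_nonneg (hx u) (sq_nonneg (q u - ∑ w, x w * q w))
    have heq : ∑ u, x u * (q u - ∑ w, x w * q w) ^ 2
        = ∑ u, x u * q u ^ 2 - (∑ w, x w * q w) ^ 2 := by
      generalize hm : ∑ w, x w * q w = m
      calc ∑ u, x u * (q u - m) ^ 2
          = ∑ u, (x u * q u ^ 2 - 2 * m * (x u * q u) + m ^ 2 * x u) :=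
            Finset.sum_congr rfl fun u _ => by ring
        _ = _ := by
            rw [Finset.sum_add_distrib, Finset.sum_sub_distrib, ← Finset.mul_sum,
              ← Finset.mul_sum, hm, hsum]
            ring
    linarith
  have hswap : ∀ F : V → V → V → ℝ, ∑ u, ∑ v, ∑ w, F v u w = ∑ u, ∑ v, ∑ w, F u v w :=
    fun F => Finset.sum_comm
  have hrot : ∀ F : V → V → V → ℝ, ∑ u, ∑ v, ∑ w, F w u v = ∑ u, ∑ v, ∑ w, F u v w := by
    intro F
    rw [← hswap F]
    exact Finset.sum_congr rfl fun u _ => Finset.sum_comm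
  have hq2 : ∑ u, ∑ v, ∑ w, x u * x v * x w * (a u v * a u w) = ∑ u, x u * q u ^ 2 := by
    refine Finset.sum_congr rfl fun u _ => ?_
    rw [sq, Finset.sum_mul_sum, Finset.mul_sum]
    refine Finset.sum_congr rfl fun v _ => ?_
    rw [Finset.mul_sum]
    exact Finset.sum_congr rfl fun w _ => by ring
  have hR : ∑ u, ∑ v, ∑ w, x u * x v * x w * ((s u v * s u w + s v u * s v w + s w u * s w v)
        - 2 * (s u v * s u w * s v w) - (a u v * a u w + a v u * a v w + a w u * a w v))
      = 3 * cherryWeight s x Finset.univ - 2 * triangleWeight s x Finset.univ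
        - 3 * ∑ u, x u * q u ^ 2 := by
    let G : V → V → V → ℝ := fun u v w => x u * x v * x w * (s u v * s u w)
    let H : V → V → V → ℝ := fun u v w => x u * x v * x w * (a u v * a u w)
    let T : V → V → V → ℝ := fun u v w => x u * x v * x w * (s u v * s u w * s v w)
    calc _ = ∑ u, ∑ v, ∑ w, (G u v w + G v u w + G w u v - 2 * T u v w
          - (H u v w + H v u w + H w u v)) :=
          Finset.sum_congr rfl fun u _ => Finset.sum_congr rfl fun v _ =>
            Finset.sum_congr rfl fun w _ => by simp only [G, H, T]; ring
      _ = 3 * (∑ u, ∑ v, ∑ w, G u v w) - 2 * (∑ u, ∑ v, ∑ w, T u v w)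
          - 3 * ∑ u, ∑ v, ∑ w, H u v w := by
          simp only [Finset.sum_sub_distrib, Finset.sum_add_distrib, hswap G, hrot G, hswap H,
            hrot H, ← Finset.mul_sum]
          ring
      _ = _ := by rw [hq2]; rfl
  have hL : ∑ u, ∑ v, ∑ w, x u * x v * x w * ((if IsFdfTriple A u v w then (1 : ℝ) else 0)
        + (if u = v then a u w else 0) + (if u = w then a u v else 0)
        + (if v = w then a v u else 0))
      = (∑ u, ∑ v, ∑ w, if IsFdfTriple A u v w then x u * x v * x w else 0) + 3 * B := by
    have h1 : ∑ u, ∑ v, ∑ w, x u * x v * x w * (if u = v then a u w else 0) = B := by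
      refine Finset.sum_congr rfl fun u _ => ?_
      rw [Finset.sum_comm]
      simp [sq]
    have h2 : ∑ u, ∑ v, ∑ w, x u * x v * x w * (if u = w then a u v else 0) = B := by
      refine Finset.sum_congr rfl fun u _ => Finset.sum_congr rfl fun v _ => ?_
      simp only [mul_ite, mul_zero, Finset.sum_ite_eq, Finset.mem_univ, if_true]
      ring
    have h3 : ∑ u, ∑ v, ∑ w, x u * x v * x w * (if v = w then a v u else 0) = B := by
      rw [Finset.sum_comm]
      refine Finset.sum_congr rfl fun u _ => Finset.sum_congr rfl fun v _ => ?_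
      simp only [mul_ite, mul_zero, Finset.sum_ite_eq, Finset.mem_univ, if_true]
      ring
    simp only [mul_add (_ * _ * _), Finset.sum_add_distrib, h1, h2, h3]
    simp only [mul_ite, mul_one, mul_zero]
    ring
  have hpoint := Finset.sum_le_sum fun u (_ : u ∈ Finset.univ) =>
    Finset.sum_le_sum fun v (_ : v ∈ Finset.univ) =>
    Finset.sum_le_sum fun w (_ : w ∈ Finset.univ) =>
    mul_le_mul_of_nonneg_left (fdfTriple_indicator_le hirr hanti u v w)
      (mul_nonneg (mul_nonneg (hx u) (hx v)) (hx w))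
  have hmain := (hL.symm.le.trans hpoint).trans hR.le
  rw [graphPotential, hedge] at hpot
  rw [hB]
  linarith
end
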